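/- Let f(x,y) = −70x² − 35xy − 2y² − 93x³ − 14x²y + 41xy² − 70y³ + 31x⁴ + 7x³y − 30x²y² + 37xy³ + 91y⁴. Then the hessian curve Z = {(x,y) ∈ ℝ² : Hess(f)(x,y) = 0} has exactly 6 connected components, of which exactly 2 are bounded subsets of ℝ² (ovals) and exactly 4 are unbounded. -/

import Mathlib

open MvPolynomial

/-- The hessian determinant of a polynomial in two variables over the reals:
`Hess f = f_xx * f_yy - f_xy ^ 2` (with formal partial derivatives). -/
noncomputable def Hess (f : MvPolynomial (Fin 2) ℝ) : MvPolynomial (Fin 2) ℝ :=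
  pderiv 0 (pderiv 0 f) * pderiv 1 (pderiv 1 f) - (pderiv 0 (pderiv 1 f)) ^ 2

/-- The set of connected components of a set `Z ⊆ ℝ × ℝ` (with its subspace
topology), viewed as subsets of `ℝ × ℝ`. -/
def components (Z : Set (ℝ × ℝ)) : Set (Set (ℝ × ℝ)) :=
  {C | ∃ p ∈ Z, C = connectedComponentIn Z p}

/-- The polynomial `f` of the statement. -/
noncomputable def f : MvPolynomial (Fin 2) ℝ :=
  -70 * (X 0)^2 - 35 * (X 0)*(X 1) - 2 * (X 1)^2 - 93 * (X 0)^3 - 14 * (X 0)^2*(X 1) + 41 * (X 0)*(X 1)^2 - 70 * (X 1)^3 + 31 * (X 0)^4 + 7 * (X 0)^3*(X 1) - 30 * (X 0)^2*(X 1)^2 + 37 * (X 0)*(X 1)^3 + 91 * (X 1)^4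

/-- The hessian curve of `f` in `ℝ²`. -/
noncomputable def Z : Set (ℝ × ℝ) := {p | eval ![p.1, p.2] (Hess f) = 0}


lemma quartic_pos_of_nonneg {h₀ h₁ h₂ h₃ h₄ s t : ℝ} (hneg : h₀ < 0) (hpos : 0 < h₄)
    (hpat : (0 ≤ h₂ ∧ 0 ≤ h₃) ∨ (h₁ ≤ 0 ∧ 0 ≤ h₃) ∨ (h₁ ≤ 0 ∧ h₂ ≤ 0))
    (hs : 0 ≤ s) (hst : s < t) (hp : 0 ≤ h₀ + h₁ * s + h₂ * s ^ 2 + h₃ * s ^ 3 + h₄ * s ^ 4) :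
    0 < h₀ + h₁ * t + h₂ * t ^ 2 + h₃ * t ^ 3 + h₄ * t ^ 4 := by
  have hs' : 0 < s := by
    rcases hs.eq_or_lt with rfl | h
    · simp at hp; linarith
    · exact h
  have ht : 0 < t := hs'.trans hst
  have h1 : 0 < t - s := sub_pos.2 hst
  have h2 : 0 < t ^ 2 - s ^ 2 := sub_pos.2 (by gcongr)
  have h3 : 0 < t ^ 3 - s ^ 3 := sub_pos.2 (by gcongr)
  rcases hpat with ⟨p, q⟩ | ⟨p, q⟩ | ⟨p, q⟩
  · have key : s * (h₀ + h₁ * t + h₂ * t ^ 2 + h₃ * t ^ 3 + h₄ * t ^ 4) =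
        t * (h₀ + h₁ * s + h₂ * s ^ 2 + h₃ * s ^ 3 + h₄ * s ^ 4) + (-h₀) * (t - s)
        + h₂ * (s * t * (t - s)) + h₃ * (s * t * (t ^ 2 - s ^ 2))
        + h₄ * (s * t * (t ^ 3 - s ^ 3)) := by ring
    refine pos_of_mul_pos_right (a := s) ?_ hs
    rw [key]
    have : 0 < (-h₀) * (t - s) := mul_pos (by linarith) h1
    positivity
  · have key : s ^ 2 * (h₀ + h₁ * t + h₂ * t ^ 2 + h₃ * t ^ 3 + h₄ * t ^ 4) =
        t ^ 2 * (h₀ + h₁ * s + h₂ * s ^ 2 + h₃ * s ^ 3 + h₄ * s ^ 4) + (-h₀) * (t ^ 2 - s ^ 2)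
        + (-h₁) * (s * t * (t - s)) + h₃ * (s ^ 2 * t ^ 2 * (t - s))
        + h₄ * (s ^ 2 * t ^ 2 * (t ^ 2 - s ^ 2)) := by ring
    refine pos_of_mul_pos_right (a := s ^ 2) ?_ (by positivity)
    rw [key]
    have : 0 < (-h₀) * (t ^ 2 - s ^ 2) := mul_pos (by linarith) h2
    have : 0 ≤ -h₁ := by linarith
    positivity
  · have key : s ^ 3 * (h₀ + h₁ * t + h₂ * t ^ 2 + h₃ * t ^ 3 + h₄ * t ^ 4) =
        t ^ 3 * (h₀ + h₁ * s + h₂ * s ^ 2 + h₃ * s ^ 3 + h₄ * s ^ 4) + (-h₀) * (t ^ 3 - s ^ 3)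
        + (-h₁) * (s * t * (t ^ 2 - s ^ 2)) + (-h₂) * (s ^ 2 * t ^ 2 * (t - s))
        + h₄ * (s ^ 3 * t ^ 3 * (t - s)) := by ring
    refine pos_of_mul_pos_right (a := s ^ 3) ?_ (by positivity)
    rw [key]
    have : 0 < (-h₀) * (t ^ 3 - s ^ 3) := mul_pos (by linarith) h3
    have : 0 ≤ -h₁ := by linarith
    have : 0 ≤ -h₂ := by linarith
    positivity

/-- `F` is a quartic polynomial function, negative at `0` and with positive leading coefficient,
whose coefficients change sign exactly once. -/
def IsOneSignChangeQuartic (F : ℝ → ℝ) : Prop :=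
  ∃ h₀ h₁ h₂ h₃ h₄ : ℝ, (∀ t, F t = h₀ + h₁ * t + h₂ * t ^ 2 + h₃ * t ^ 3 + h₄ * t ^ 4) ∧
    h₀ < 0 ∧ 0 < h₄ ∧
    ((0 ≤ h₂ ∧ 0 ≤ h₃) ∨ (h₁ ≤ 0 ∧ 0 ≤ h₃) ∨ (h₁ ≤ 0 ∧ h₂ ≤ 0))

namespace IsOneSignChangeQuartic

lemma neg_zero {F : ℝ → ℝ} (hF : IsOneSignChangeQuartic F) : F 0 < 0 := by
  obtain ⟨h₀, h₁, h₂, h₃, h₄, h, hneg, -⟩ := hF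
  simpa [h] using hneg

lemma pos_of_nonneg {F : ℝ → ℝ} (hF : IsOneSignChangeQuartic F) {s t : ℝ} (hs : 0 ≤ s)
    (hst : s < t) (hp : 0 ≤ F s) : 0 < F t := by
  obtain ⟨h₀, h₁, h₂, h₃, h₄, h, hneg, hpos, hpat⟩ := hF
  rw [h] at hp ⊢
  exact quartic_pos_of_nonneg hneg hpos hpat hs hst hp

lemma exists_root {F : ℝ → ℝ} (hF : IsOneSignChangeQuartic F) : ∃ t, 0 < t ∧ F t = 0 := by
  have h0 := hF.neg_zero
  obtain ⟨h₀, h₁, h₂, h₃, h₄, h, hneg, hpos, -⟩ := hF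
  set M : ℝ := 1 + (|h₀| + |h₁| + |h₂| + |h₃|) / h₄
  have hM : 1 ≤ M := by simp only [M, le_add_iff_nonneg_right]; positivity
  have hM' : h₄ * (M - 1) = |h₀| + |h₁| + |h₂| + |h₃| := by simp only [M]; field_simp; ring
  have hFM : 0 ≤ F M := by
    rw [h]
    have e0 : -|h₀| * M ^ 3 ≤ h₀ := by
      nlinarith [neg_abs_le h₀, abs_nonneg h₀, one_le_pow₀ hM (n := 3)]
    have e1 : -|h₁| * M ^ 3 ≤ h₁ * M := by
      have : M ≤ M ^ 3 := le_self_pow₀ hM (by norm_num)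
      nlinarith [neg_abs_le h₁, abs_nonneg h₁]
    have e2 : -|h₂| * M ^ 3 ≤ h₂ * M ^ 2 := by
      have : M ^ 2 ≤ M ^ 3 := pow_le_pow_right₀ hM (by norm_num)
      nlinarith [neg_abs_le h₂, abs_nonneg h₂, sq_nonneg M]
    have e3 : -|h₃| * M ^ 3 ≤ h₃ * M ^ 3 := by
      gcongr
      exact neg_abs_le h₃
    have e4 : h₄ * M ^ 4 = (h₄ * (M - 1)) * M ^ 3 + h₄ * M ^ 3 := by ring
    rw [hM'] at e4
    have : 0 < h₄ * M ^ 3 := by positivity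
    linarith
  have hc : Continuous F := by
    rw [funext h]; fun_prop
  obtain ⟨t, ht, hFt⟩ := intermediate_value_Icc (zero_le_one.trans hM) hc.continuousOn
    (show (0 : ℝ) ∈ Set.Icc (F 0) (F M) from ⟨h0.le, hFM⟩)
  refine ⟨t, lt_of_le_of_ne ht.1 ?_, hFt⟩
  rintro rfl
  exact h0.ne hFt

end IsOneSignChangeQuartic

lemma exists_continuous_root {S : Type*} [TopologicalSpace S] (F : S → ℝ → ℝ)
    (hc : ∀ t, Continuous fun s => F s t) (hF : ∀ s, IsOneSignChangeQuartic (F s)) :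
    ∃ g : S → ℝ, Continuous g ∧ (∀ s, 0 < g s) ∧ ∀ s t, 0 ≤ t → (F s t = 0 ↔ t = g s) := by
  choose g hg0 hg using fun s => (hF s).exists_root
  have hlt : ∀ s t, 0 ≤ t → (g s < t ↔ 0 < F s t) := by
    intro s t ht
    refine ⟨fun h => (hF s).pos_of_nonneg (hg0 s).le h (hg s).ge, fun h => ?_⟩
    by_contra! hle
    rcases hle.eq_or_lt with rfl | hlt
    · exact h.ne' (hg s)
    · exact ((hF s).pos_of_nonneg ht hlt h.le).ne' (hg s)
  have hgt : ∀ s t, 0 ≤ t → (t < g s ↔ F s t < 0) := by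
    intro s t ht
    refine ⟨fun h => ?_, fun h => ?_⟩
    · by_contra! hle
      exact ((hF s).pos_of_nonneg ht h hle).ne' (hg s)
    · by_contra! hle
      rcases hle.eq_or_lt with h' | h'
      · exact h.ne (h' ▸ hg s)
      · exact h.not_gt ((hlt s t ht).1 h')
  refine ⟨g, ?_, hg0, ?_⟩
  · refine OrderTopology.continuous_iff.2 fun a => ⟨?_, ?_⟩
    · rcases lt_or_ge a 0 with ha | ha
      · convert isOpen_univ using 1
        exact Set.eq_univ_of_forall fun s => ha.trans (hg0 s)
      · convert isOpen_lt (hc a) continuous_const using 1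
        exact Set.ext fun s => hgt s a ha
    · rcases lt_or_ge a 0 with ha | ha
      · convert isOpen_empty using 1
        exact Set.eq_empty_of_forall_notMem fun s hs => (ha.trans (hg0 s)).not_gt hs
      · convert isOpen_lt continuous_const (hc a) using 1
        exact Set.ext fun s => hlt s a ha
  · intro s t ht
    refine ⟨fun h => ?_, fun h => h ▸ hg s⟩
    rcases lt_trichotomy t (g s) with h' | h' | h'
    · exact absurd h ((hgt s t ht).1 h').ne
    · exact h'
    · exact absurd h ((hlt s t ht).1 h').ne'

/-- The homogenization of the hessian determinant of `f`. -/
def homHess (v : ℝ × ℝ × ℝ) : ℝ :=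
  (-140 * v.2.2 ^ 2 - 558 * v.1 * v.2.2 - 28 * v.2.1 * v.2.2 + 372 * v.1 ^ 2
    + 42 * v.1 * v.2.1 - 60 * v.2.1 ^ 2) *
  (-4 * v.2.2 ^ 2 + 82 * v.1 * v.2.2 - 420 * v.2.1 * v.2.2 - 60 * v.1 ^ 2
    + 222 * v.1 * v.2.1 + 1092 * v.2.1 ^ 2) -
  (-35 * v.2.2 ^ 2 - 28 * v.1 * v.2.2 + 82 * v.2.1 * v.2.2 + 21 * v.1 ^ 2
    - 120 * v.1 * v.2.1 + 111 * v.2.1 ^ 2) ^ 2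

lemma homHess_smul (k : ℝ) (v : ℝ × ℝ × ℝ) : homHess (k • v) = k ^ 4 * homHess v := by
  simp only [homHess, Prod.smul_fst, Prod.smul_snd, smul_eq_mul]
  ring

lemma continuous_homHess : Continuous homHess := by
  unfold homHess
  fun_prop

lemma mem_Z_iff (p : ℝ × ℝ) : p ∈ Z ↔ homHess (p.1, p.2, 1) = 0 := by
  have h : eval ![p.1, p.2] (Hess f) = homHess (p.1, p.2, 1) := by
    have hn : ∀ (i : Fin 2) (n : ℕ) [n.AtLeastTwo],
        pderiv i (OfNat.ofNat n : MvPolynomial (Fin 2) ℝ) = 0 := fun i n _ =>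
      (pderiv i).map_natCast n
    simp [Hess, f, homHess, Derivation.leibniz, Derivation.leibniz_pow, pderiv_X, hn]
    ring
  rw [← h]
  rfl

/-- The affine point with homogeneous coordinates `v`. -/
noncomputable def affinePoint (v : ℝ × ℝ × ℝ) : ℝ × ℝ := (v.1 / v.2.2, v.2.1 / v.2.2)

/-- The affine part of the projective triangle with vertices `A`, `B`, `C`. -/
def triangle (A B C : ℝ × ℝ × ℝ) : Set (ℝ × ℝ) :=
  {p | ∃ α β γ : ℝ, 0 ≤ α ∧ 0 ≤ β ∧ 0 ≤ γ ∧ 0 < β * B.2.2 + γ * C.2.2 ∧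
    ((p.1, p.2, 1) : ℝ × ℝ × ℝ) = α • A + β • B + γ • C}

/-- Every segment from the edge `BC` to the vertex `A` crosses the hessian curve of `f`
in the way prescribed by `IsOneSignChangeQuartic`. -/
structure IsCrossed (A B C : ℝ × ℝ × ℝ) : Prop where
  nonneg : 0 ≤ A.2.2
  nonneg_left : 0 ≤ B.2.2
  nonneg_right : 0 ≤ C.2.2
  pos_add : 0 < B.2.2 + C.2.2
  homHess_pos : 0 < homHess A
  eq_zero_or : A.2.2 = 0 ∨ (0 < B.2.2 ∧ 0 < C.2.2)
  quartic : ∀ β γ : ℝ, 0 ≤ β → 0 ≤ γ → 0 < β + γ →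
    IsOneSignChangeQuartic fun t => homHess (β • B + γ • C + t • A)

lemma affinePoint_mem_Z {v : ℝ × ℝ × ℝ} (hv : v.2.2 ≠ 0) (h : homHess v = 0) :
    affinePoint v ∈ Z := by
  rw [mem_Z_iff]
  have : (((affinePoint v).1, (affinePoint v).2, 1) : ℝ × ℝ × ℝ) = v.2.2⁻¹ • v := by
    ext <;> simp [affinePoint, hv, div_eq_inv_mul]
  rw [this, homHess_smul, h, mul_zero]

lemma affinePoint_mem_triangle {A B C : ℝ × ℝ × ℝ} {α β γ : ℝ} (hA : 0 ≤ A.2.2) (hα : 0 ≤ α)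
    (hβ : 0 ≤ β) (hγ : 0 ≤ γ) (hw : 0 < β * B.2.2 + γ * C.2.2) :
    affinePoint (β • B + γ • C + α • A) ∈ triangle A B C := by
  have hv : 0 < β * B.2.2 + γ * C.2.2 + α * A.2.2 := by positivity
  refine ⟨α / (β * B.2.2 + γ * C.2.2 + α * A.2.2), β / (β * B.2.2 + γ * C.2.2 + α * A.2.2),
    γ / (β * B.2.2 + γ * C.2.2 + α * A.2.2), by positivity, by positivity, by positivity, ?_, ?_⟩
  · rw [div_mul_eq_mul_div, div_mul_eq_mul_div, ← add_div]
    positivity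
  · ext <;> simp [affinePoint] <;> field_simp <;> ring

namespace IsCrossed

variable {A B C : ℝ × ℝ × ℝ}

lemma exists_mem (h : IsCrossed A B C) {β γ : ℝ} (hβ : 0 ≤ β) (hγ : 0 ≤ γ)
    (hw : 0 < β * B.2.2 + γ * C.2.2) :
    ∃ t : ℝ, 0 < t ∧ affinePoint (β • B + γ • C + t • A) ∈ Z ∩ triangle A B C := by
  have hs : 0 < β + γ := by
    by_contra! hs
    have h1 : β = 0 := by linarith
    have h2 : γ = 0 := by linarith
    simp [h1, h2] at hw
  obtain ⟨t, ht, hroot⟩ := (h.quartic β γ hβ hγ hs).exists_root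
  have := h.nonneg
  refine ⟨t, ht, affinePoint_mem_Z ?_ hroot, affinePoint_mem_triangle h.nonneg ht.le hβ hγ hw⟩
  have : 0 < β * B.2.2 + γ * C.2.2 + t * A.2.2 := by positivity
  simpa using this.ne'

lemma isPreconnected (h : IsCrossed A B C) : IsPreconnected (Z ∩ triangle A B C) := by
  let S : Set (ℝ × ℝ) := {x | 0 ≤ x.1 ∧ 0 ≤ x.2 ∧ 0 < x.1 * B.2.2 + x.2 * C.2.2}
  have hS : Convex ℝ S := by
    rintro x ⟨hx1, hx2, hx3⟩ y ⟨hy1, hy2, hy3⟩ a b ha hb hab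
    refine ⟨?_, ?_, ?_⟩
    · simp only [Prod.fst_add, Prod.smul_fst, smul_eq_mul]
      positivity
    · simp only [Prod.snd_add, Prod.smul_snd, smul_eq_mul]
      positivity
    · have : 0 < a * (x.1 * B.2.2 + x.2 * C.2.2) + b * (y.1 * B.2.2 + y.2 * C.2.2) := by
        rcases ha.eq_or_lt with rfl | ha
        · have : 0 < b := by linarith
          positivity
        · positivity
      simp only [Prod.fst_add, Prod.smul_fst, Prod.snd_add, Prod.smul_snd, smul_eq_mul]
      linarith
  have hsum : ∀ s : S, 0 < s.1.1 + s.1.2 := by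
    rintro ⟨s, h1, h2, h3⟩
    by_contra! hs
    have e1 : s.1 = 0 := by simp only at hs; linarith
    have e2 : s.2 = 0 := by simp only at hs; linarith
    simp [e1, e2] at h3
  have : PreconnectedSpace S := Subtype.preconnectedSpace hS.isPreconnected
  obtain ⟨g, hgc, hg0, hg⟩ := exists_continuous_root
    (fun (s : S) t => homHess (s.1.1 • B + s.1.2 • C + t • A))
    (fun t => continuous_homHess.comp (by fun_prop))
    (fun s => h.quartic _ _ s.2.1 s.2.2.1 (hsum s))
  have hpos : ∀ s : S, 0 < (s.1.1 • B + s.1.2 • C + g s • A).2.2 := by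
    intro s
    have h1 := s.2.2.2
    have h2 := hg0 s
    have h3 := h.nonneg
    have : 0 < s.1.1 * B.2.2 + s.1.2 * C.2.2 + g s * A.2.2 := by positivity
    simpa using this
  have hrange : Z ∩ triangle A B C =
      Set.range fun s : S => affinePoint (s.1.1 • B + s.1.2 • C + g s • A) := by
    ext p
    constructor
    · rintro ⟨hpZ, α, β, γ, hα, hβ, hγ, hw, hp⟩
      rw [mem_Z_iff, hp, add_assoc, add_comm] at hpZ
      have hαg := (hg ⟨(β, γ), hβ, hγ, hw⟩ α hα).1 hpZ
      refine ⟨⟨(β, γ), hβ, hγ, hw⟩, ?_⟩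
      dsimp only
      rw [← hαg, add_comm, ← add_assoc, ← hp]
      simp [affinePoint]
    · rintro ⟨s, rfl⟩
      exact ⟨affinePoint_mem_Z (hpos s).ne' ((hg s _ (hg0 s).le).2 rfl),
        affinePoint_mem_triangle h.nonneg (hg0 s).le s.2.1 s.2.2.1 s.2.2.2⟩
  rw [hrange]
  refine isPreconnected_range ?_
  unfold affinePoint
  exact (Continuous.div (by fun_prop) (by fun_prop) fun s => (hpos s).ne').prodMk
    (Continuous.div (by fun_prop) (by fun_prop) fun s => (hpos s).ne')

end IsCrossed

/-- The value at `v` of the linear form with coefficients `l`. -/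
def form (l v : ℝ × ℝ × ℝ) : ℝ := l.1 * v.1 + l.2.1 * v.2.1 + l.2.2 * v.2.2

/-- The determinant of three vectors. -/
def det₃ (u v w : ℝ × ℝ × ℝ) : ℝ :=
  u.1 * (v.2.1 * w.2.2 - v.2.2 * w.2.1) - u.2.1 * (v.1 * w.2.2 - v.2.2 * w.1)
    + u.2.2 * (v.1 * w.2.1 - v.2.1 * w.1)

/-- The union of the triangles with vertex `A` whose opposite edges form a given polygonal
chain. -/
def fan (A : ℝ × ℝ × ℝ) : List (ℝ × ℝ × ℝ) → Set (ℝ × ℝ)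
  | B :: C :: l => triangle A B C ∪ fan A (C :: l)
  | _ => ∅

/-- All triangles of a fan are crossed by the hessian curve, and the inner vertices of its
polygonal chain are affine points. -/
def IsCrossedFan (A : ℝ × ℝ × ℝ) : List (ℝ × ℝ × ℝ) → Prop
  | B :: C :: D :: l => IsCrossed A B C ∧ 0 < C.2.2 ∧ IsCrossedFan A (C :: D :: l)
  | [B, C] => IsCrossed A B C
  | _ => True

lemma IsCrossedFan.isCrossed {A B C : ℝ × ℝ × ℝ} {l : List (ℝ × ℝ × ℝ)}
    (h : IsCrossedFan A (B :: C :: l)) : IsCrossed A B C := by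
  cases l with
  | nil => exact h
  | cons D l => exact h.1

lemma IsCrossedFan.tail {A B : ℝ × ℝ × ℝ} {l : List (ℝ × ℝ × ℝ)}
    (h : IsCrossedFan A (B :: l)) : IsCrossedFan A l := by
  match l, h with
  | [], _ => trivial
  | [C], _ => trivial
  | C :: D :: l, h => exact h.2.2

lemma IsCrossedFan.isPreconnected {A : ℝ × ℝ × ℝ} {l : List (ℝ × ℝ × ℝ)}
    (h : IsCrossedFan A l) : IsPreconnected (Z ∩ fan A l) := by
  match l, h with
  | [], _ => simpa [fan] using isPreconnected_empty
  | [B], _ => simpa [fan] using isPreconnected_empty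
  | [B, C], h => simpa [fan] using IsCrossed.isPreconnected h
  | B :: C :: D :: l, h =>
    obtain ⟨h1, hC, h2⟩ := h
    obtain ⟨t, ht, hZ, htri⟩ := h1.exists_mem le_rfl zero_le_one (by simpa using hC)
    have htri' := affinePoint_mem_triangle (B := C) (C := D) h1.nonneg ht.le zero_le_one le_rfl
      (by simpa using hC)
    rw [zero_smul, zero_add] at hZ htri
    rw [zero_smul, add_zero] at htri'
    rw [fan, Set.inter_union_distrib_left]
    exact h1.isPreconnected.union _ ⟨hZ, htri⟩ ⟨hZ, Or.inl htri'⟩ h2.isPreconnected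

lemma IsCrossedFan.nonempty {A B C : ℝ × ℝ × ℝ} {l : List (ℝ × ℝ × ℝ)}
    (h : IsCrossedFan A (B :: C :: l)) : (Z ∩ fan A (B :: C :: l)).Nonempty := by
  obtain ⟨t, -, hZ, ht⟩ := h.isCrossed.exists_mem zero_le_one zero_le_one
    (by simpa using h.isCrossed.pos_add)
  exact ⟨_, hZ, Or.inl ht⟩

lemma IsCrossedFan.form_pos {A : ℝ × ℝ × ℝ} {l : List (ℝ × ℝ × ℝ)} (h : IsCrossedFan A l)
    {k : ℝ × ℝ × ℝ} (hA : 0 < form k A) (hl : ∀ P ∈ l, 0 ≤ form k P) {p : ℝ × ℝ}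
    (hp : p ∈ Z ∩ fan A l) : 0 < form k (p.1, p.2, 1) := by
  match l, h with
  | [], _ => exact hp.2.elim
  | [B], _ => exact hp.2.elim
  | B :: C :: l, h =>
    rcases hp with ⟨hpZ, ⟨α, β, γ, hα, hβ, hγ, hw, hp⟩ | hp⟩
    · have hα' : 0 < α := by
        refine hα.lt_of_ne fun hα0 => ?_
        have hs : 0 < β + γ := by
          by_contra! hs
          have h1 : β = 0 := by linarith
          have h2 : γ = 0 := by linarith
          simp [h1, h2] at hw
        have hneg := (h.isCrossed.quartic β γ hβ hγ hs).neg_zero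
        rw [mem_Z_iff, hp, ← hα0, zero_smul, zero_add] at hpZ
        simp only [zero_smul, add_zero] at hneg
        exact hneg.ne hpZ
      have hB := hl B (by simp)
      have hC := hl C (by simp)
      have key : form k (p.1, p.2, 1) = α * form k A + β * form k B + γ * form k C := by
        rw [hp]
        simp only [form, Prod.fst_add, Prod.snd_add, Prod.smul_fst, Prod.smul_snd, smul_eq_mul]
        ring
      rw [key]
      positivity
    · exact h.tail.form_pos hA (fun P hP => hl P (List.mem_cons_of_mem _ hP)) ⟨hpZ, hp⟩

lemma IsCrossed.mem_triangle {A B C : ℝ × ℝ × ℝ} (h : IsCrossed A B C) {p : ℝ × ℝ} (hpZ : p ∈ Z)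
    (hD : 0 < det₃ A B C) (hBC : 0 ≤ det₃ (p.1, p.2, 1) B C) (hB : 0 ≤ det₃ A B (p.1, p.2, 1))
    (hC : det₃ A C (p.1, p.2, 1) ≤ 0) : p ∈ triangle A B C := by
  set v : ℝ × ℝ × ℝ := (p.1, p.2, 1) with hv
  have hp : v = (det₃ v B C / det₃ A B C) • A + (-det₃ A C v / det₃ A B C) • B
      + (det₃ A B v / det₃ A B C) • C := by
    have hD' := hD.ne'
    ext <;> simp only [Prod.fst_add, Prod.snd_add, Prod.smul_fst, Prod.smul_snd, smul_eq_mul] <;>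
      field_simp <;> simp only [det₃] <;> ring
  have hβ : 0 ≤ -det₃ A C v / det₃ A B C := div_nonneg (by linarith) hD.le
  have hγ : 0 ≤ det₃ A B v / det₃ A B C := div_nonneg hB hD.le
  refine ⟨_, _, _, div_nonneg hBC hD.le, hβ, hγ, ?_, hp⟩
  generalize det₃ v B C / det₃ A B C = α at *
  generalize -det₃ A C v / det₃ A B C = β at *
  generalize det₃ A B v / det₃ A B C = γ at *
  have hw : 1 = α * A.2.2 + β * B.2.2 + γ * C.2.2 := by
    simpa [hv] using congrArg (fun u : ℝ × ℝ × ℝ => u.2.2) hp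
  rcases h.eq_zero_or with h0 | ⟨h1, h2⟩
  · rw [h0] at hw
    linarith
  · rcases hβ.eq_or_lt with rfl | hβ
    · rcases hγ.eq_or_lt with rfl | hγ
      · exfalso
        rw [mem_Z_iff, ← hv, hp, zero_smul, zero_smul, add_zero, add_zero, homHess_smul,
          mul_eq_zero_iff_right h.homHess_pos.ne'] at hpZ
        simp [pow_eq_zero_iff (four_ne_zero) |>.1 hpZ] at hw
      · positivity
    · positivity

lemma IsCrossedFan.mem_fan {A B : ℝ × ℝ × ℝ} {l : List (ℝ × ℝ × ℝ)} (h : IsCrossedFan A (B :: l))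
    {p : ℝ × ℝ} (hpZ : p ∈ Z)
    (hl : (B :: l).IsChain fun B C => 0 < det₃ A B C ∧ 0 ≤ det₃ (p.1, p.2, 1) B C)
    (hB : 0 ≤ det₃ A B (p.1, p.2, 1)) (hex : ∃ C ∈ l, det₃ A C (p.1, p.2, 1) ≤ 0) :
    p ∈ fan A (B :: l) := by
  induction l generalizing B with
  | nil => simp at hex
  | cons C l ih =>
    rw [List.isChain_cons_cons] at hl
    rcases le_or_gt (det₃ A C (p.1, p.2, 1)) 0 with hC | hC
    · exact Or.inl (h.isCrossed.mem_triangle hpZ hl.1.1 hl.1.2 hB hC)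
    · refine Or.inr (ih h.tail hl.2 hC.le ?_)
      obtain ⟨D, hD, hDp⟩ := hex
      rcases List.mem_cons.1 hD with rfl | hD
      · exact absurd hDp hC.not_ge
      · exact ⟨D, hD, hDp⟩

lemma IsCrossedFan.drop {A : ℝ × ℝ × ℝ} {l : List (ℝ × ℝ × ℝ)} (h : IsCrossedFan A l) (n : ℕ) :
    IsCrossedFan A (l.drop n) := by
  induction n generalizing l with
  | zero => exact h
  | succ n ih =>
    cases l with
    | nil => exact h
    | cons B l => exact ih h.tail

lemma fan_drop_subset (A : ℝ × ℝ × ℝ) (l : List (ℝ × ℝ × ℝ)) (n : ℕ) :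
    fan A (l.drop n) ⊆ fan A l := by
  induction n generalizing l with
  | zero => exact subset_rfl
  | succ n ih =>
    match l with
    | [] => exact subset_rfl
    | [B] => simp [fan]
    | B :: C :: l => exact (ih (C :: l)).trans Set.subset_union_right

lemma IsCrossedFan.mem_fan_of_drop {A B : ℝ × ℝ × ℝ} {l l' : List (ℝ × ℝ × ℝ)}
    (h : IsCrossedFan A l) {p : ℝ × ℝ} (hpZ : p ∈ Z)
    (hl : l.IsChain fun B C => 0 < det₃ A B C ∧ 0 ≤ det₃ (p.1, p.2, 1) B C) (n : ℕ)
    (hn : l.drop n = B :: l') (hB : 0 ≤ det₃ A B (p.1, p.2, 1))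
    (hex : ∃ C ∈ l', det₃ A C (p.1, p.2, 1) ≤ 0) : p ∈ fan A l :=
  fan_drop_subset A l n (hn ▸ (hn ▸ h.drop n : IsCrossedFan A (B :: l')).mem_fan hpZ
    (hn ▸ hl.drop n) hB hex)

lemma IsCrossedFan.not_isBounded {A B C : ℝ × ℝ × ℝ} {l : List (ℝ × ℝ × ℝ)}
    (h : IsCrossedFan A (B :: C :: l)) (hA : A.2.2 = 0) (hB : B.2.2 = 0) (hC : 0 < C.2.2)
    {a b : ℝ} (hAab : 0 ≤ a * A.1 + b * A.2.1) (hBab : 0 < a * B.1 + b * B.2.1) :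
    ¬ Bornology.IsBounded (Z ∩ fan A (B :: C :: l)) := by
  intro hb
  obtain ⟨R, hR⟩ := hb.exists_norm_le
  set c := a * C.1 + b * C.2.1 with hc
  set β := ((|a| + |b|) * |R| * C.2.2 + |c| + 1) / (a * B.1 + b * B.2.1) with hβ
  have hβ0 : 0 ≤ β := by positivity
  obtain ⟨t, ht, hZ, htri⟩ := h.isCrossed.exists_mem hβ0 zero_le_one (by simp [hB, hC])
  have hq := (hR _ ⟨hZ, Or.inl htri⟩).trans (le_abs_self R)
  set q := affinePoint (β • B + (1 : ℝ) • C + t • A) with hqdef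
  have hx : q.1 * C.2.2 = β * B.1 + C.1 + t * A.1 := by
    have := hC.ne'
    simp [hqdef, affinePoint, hA, hB]
    field_simp
  have hy : q.2 * C.2.2 = β * B.2.1 + C.2.1 + t * A.2.1 := by
    have := hC.ne'
    simp [hqdef, affinePoint, hA, hB]
    field_simp
  have h1 : |q.1| ≤ |R| := (norm_fst_le q).trans hq
  have h2 : |q.2| ≤ |R| := (norm_snd_le q).trans hq
  have h3 : a * q.1 + b * q.2 ≤ (|a| + |b|) * |R| := by
    calc a * q.1 + b * q.2 ≤ |a| * |q.1| + |b| * |q.2| := by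
          rw [← abs_mul, ← abs_mul]
          exact add_le_add (le_abs_self _) (le_abs_self _)
      _ ≤ |a| * |R| + |b| * |R| := by gcongr
      _ = (|a| + |b|) * |R| := by ring
  have h4 : (a * q.1 + b * q.2) * C.2.2 ≤ (|a| + |b|) * |R| * C.2.2 := by gcongr
  have h5 : (a * q.1 + b * q.2) * C.2.2 =
      β * (a * B.1 + b * B.2.1) + c + t * (a * A.1 + b * A.2.1) := by
    linear_combination a * hx + b * hy + hc
  have h6 : β * (a * B.1 + b * B.2.1) = (|a| + |b|) * |R| * C.2.2 + |c| + 1 := by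
    rw [hβ, div_mul_cancel₀ _ hBab.ne']
  have h7 : 0 ≤ t * (a * A.1 + b * A.2.1) := by positivity
  linarith [neg_abs_le c]

lemma isCrossed_of_coeffs {A B C : ℝ × ℝ × ℝ}
    (hw : (0 ≤ A.2.2 ∧ 0 ≤ B.2.2 ∧ 0 ≤ C.2.2 ∧ 0 < B.2.2 + C.2.2) ∧
      (A.2.2 = 0 ∨ (0 < B.2.2 ∧ 0 < C.2.2)))
    (a₀ a₁ a₂ a₃ a₄ b₀ b₁ b₂ b₃ c₀ c₁ c₂ d₀ d₁ e : ℝ)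
    (h : ∀ β γ t : ℝ, homHess (β • B + γ • C + t • A) =
      (a₀ * β ^ 4 + a₁ * β ^ 3 * γ + a₂ * β ^ 2 * γ ^ 2 + a₃ * β * γ ^ 3 + a₄ * γ ^ 4)
      + (b₀ * β ^ 3 + b₁ * β ^ 2 * γ + b₂ * β * γ ^ 2 + b₃ * γ ^ 3) * t
      + (c₀ * β ^ 2 + c₁ * β * γ + c₂ * γ ^ 2) * t ^ 2 + (d₀ * β + d₁ * γ) * t ^ 3 + e * t ^ 4)
    (ha : a₀ < 0 ∧ a₁ ≤ 0 ∧ a₂ ≤ 0 ∧ a₃ ≤ 0 ∧ a₄ < 0) (he : 0 < e)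
    (hpat : ((0 ≤ c₀ ∧ 0 ≤ c₁ ∧ 0 ≤ c₂) ∧ 0 ≤ d₀ ∧ 0 ≤ d₁) ∨
      ((b₀ ≤ 0 ∧ b₁ ≤ 0 ∧ b₂ ≤ 0 ∧ b₃ ≤ 0) ∧ 0 ≤ d₀ ∧ 0 ≤ d₁) ∨
      ((b₀ ≤ 0 ∧ b₁ ≤ 0 ∧ b₂ ≤ 0 ∧ b₃ ≤ 0) ∧ c₀ ≤ 0 ∧ c₁ ≤ 0 ∧ c₂ ≤ 0)) :
    IsCrossed A B C := by
  obtain ⟨⟨hA, hB, hC, hBC⟩, h0⟩ := hw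
  have hA' : homHess A = e := by simpa using h 0 0 1
  refine ⟨hA, hB, hC, hBC, hA' ▸ he, h0, fun β γ hβ hγ hs => ⟨_, _, _, _, _, h β γ, ?_, he, ?_⟩⟩
  · obtain ⟨ha0, ha1, ha2, ha3, ha4⟩ := ha
    have h1 : a₁ * β ^ 3 * γ ≤ 0 := by
      rw [mul_assoc]; exact mul_nonpos_of_nonpos_of_nonneg ha1 (by positivity)
    have h2 : a₂ * β ^ 2 * γ ^ 2 ≤ 0 := by
      rw [mul_assoc]; exact mul_nonpos_of_nonpos_of_nonneg ha2 (by positivity)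
    have h3 : a₃ * β * γ ^ 3 ≤ 0 := by
      rw [mul_assoc]; exact mul_nonpos_of_nonpos_of_nonneg ha3 (by positivity)
    have h4 : a₀ * β ^ 4 + a₄ * γ ^ 4 < 0 := by
      rcases hβ.eq_or_lt with rfl | hβ
      · have : 0 < γ ^ 4 := by rw [zero_add] at hs; positivity
        nlinarith
      · have : 0 < β ^ 4 := by positivity
        have : 0 ≤ γ ^ 4 := by positivity
        nlinarith
    linarith
  · have hb : b₀ ≤ 0 ∧ b₁ ≤ 0 ∧ b₂ ≤ 0 ∧ b₃ ≤ 0 →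
        b₀ * β ^ 3 + b₁ * β ^ 2 * γ + b₂ * β * γ ^ 2 + b₃ * γ ^ 3 ≤ 0 := by
      rintro ⟨h0, h1, h2, h3⟩
      have : 0 ≤ (-b₀) * β ^ 3 + (-b₁) * β ^ 2 * γ + (-b₂) * β * γ ^ 2 + (-b₃) * γ ^ 3 := by
        have := neg_nonneg.2 h0; have := neg_nonneg.2 h1
        have := neg_nonneg.2 h2; have := neg_nonneg.2 h3
        positivity
      linarith
    have hd : 0 ≤ d₀ ∧ 0 ≤ d₁ → 0 ≤ d₀ * β + d₁ * γ := by
      rintro ⟨h0, h1⟩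
      positivity
    refine hpat.imp (And.imp ?_ hd) (Or.imp (And.imp hb hd) (And.imp hb ?_))
    · rintro ⟨h0, h1, h2⟩
      positivity
    · rintro ⟨h0, h1, h2⟩
      have : 0 ≤ (-c₀) * β ^ 2 + (-c₁) * β * γ + (-c₂) * γ ^ 2 := by
        have := neg_nonneg.2 h0; have := neg_nonneg.2 h1; have := neg_nonneg.2 h2
        positivity
      linarith

lemma connectedComponentIn_eq_of_isOpen_cover {X ι : Type*} [TopologicalSpace X] {S : Set X}
    {U K : ι → Set X} (hU : ∀ i, IsOpen (U i)) (hdisj : Pairwise fun i j => Disjoint (U i) (U j))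
    (hK : ∀ i, IsPreconnected (K i)) (hKU : ∀ i, K i ⊆ U i) (hS : S = ⋃ i, K i) {i : ι} {p : X}
    (hp : p ∈ K i) : connectedComponentIn S p = K i := by
  have hKS : ∀ j, K j ⊆ S := fun j => hS ▸ Set.subset_iUnion K j
  refine (Set.Subset.antisymm ?_ ((hK i).subset_connectedComponentIn hp (hKS i)))
  have hsub : connectedComponentIn S p ⊆ U i := by
    refine isPreconnected_connectedComponentIn.subset_left_of_subset_union (hU i)
      (isOpen_iUnion fun j => isOpen_iUnion fun _ : j ≠ i => hU j) ?_ ?_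
      ⟨p, mem_connectedComponentIn (hKS i hp), hKU i hp⟩
    · exact Set.disjoint_iUnion_right.2 fun j => Set.disjoint_iUnion_right.2 fun hj => hdisj hj.symm
    · intro q hq
      have hq' := connectedComponentIn_subset S p hq
      rw [hS, Set.mem_iUnion] at hq'
      obtain ⟨j, hj⟩ := hq'
      by_cases hji : j = i
      · exact Or.inl (hji ▸ hKU j hj)
      · exact Or.inr (Set.mem_iUnion₂.2 ⟨j, hji, hKU j hj⟩)
  intro q hq
  have hq' := connectedComponentIn_subset S p hq
  rw [hS, Set.mem_iUnion] at hq'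
  obtain ⟨j, hj⟩ := hq'
  by_cases hji : j = i
  · exact hji ▸ hj
  · exact absurd (hsub hq) ((hdisj hji).notMem_of_mem_left (hKU j hj))

lemma components_eq_range {ι : Type*} {S : Set (ℝ × ℝ)}
    {U K : ι → Set (ℝ × ℝ)} (hU : ∀ i, IsOpen (U i))
    (hdisj : Pairwise fun i j => Disjoint (U i) (U j)) (hK : ∀ i, IsPreconnected (K i))
    (hne : ∀ i, (K i).Nonempty) (hKU : ∀ i, K i ⊆ U i) (hS : S = ⋃ i, K i) :
    components S = Set.range K ∧ Function.Injective K := by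
  refine ⟨?_, fun i j hij => ?_⟩
  · ext D
    constructor
    · rintro ⟨p, hp, rfl⟩
      rw [hS, Set.mem_iUnion] at hp
      obtain ⟨i, hi⟩ := hp
      exact ⟨i, (connectedComponentIn_eq_of_isOpen_cover hU hdisj hK hKU hS hi).symm⟩
    · rintro ⟨i, rfl⟩
      obtain ⟨p, hp⟩ := hne i
      exact ⟨p, hS ▸ Set.mem_iUnion_of_mem i hp,
        (connectedComponentIn_eq_of_isOpen_cover hU hdisj hK hKU hS hp).symm⟩
  · by_contra h
    obtain ⟨p, hp⟩ := hne i
    exact (hdisj h).notMem_of_mem_left (hKU i hp) (hKU j (hij ▸ hp))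

/-- For each of the six components of the hessian curve, a point of the projective plane in the
convex region bounded by it. -/
def apex : Fin 6 → ℝ × ℝ × ℝ :=
  ![(1, 2, 10), (31, 1, 20), (-5, 6, 0), (-5, -9, 0), (5, 9, 0), (2, -3, 0)]

/-- For each of the six components of the hessian curve, a polygonal chain separating it from
the other ones. -/
def chain : Fin 6 → List (ℝ × ℝ × ℝ) :=
  ![[(-12, 3, 20), (-20, -1, 100), (20, -17, 100), (100, -49, 100), (100, 11, 100),
     (100, 71, 100), (100, 191, 100), (20, 103, 100), (-20, 59, 100), (-40, 37, 100),
     (-12, 3, 20)],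
    [(40, -1, 20), (140, 13, 80), (12, 3, 8), (5, 4, 5), (40, 3, 40), (20, -13, 20),
     (30, -7, 20), (35, -4, 20), (40, -1, 20)],
    [(-1, 0, 0), (-12, 3, 20), (-40, 37, 100), (-20, 59, 100), (20, 103, 100), (100, 191, 100),
     (0, 1, 0)],
    [(0, -1, 0), (100, -49, 100), (20, -17, 100), (-20, -1, 100), (-12, 3, 20), (-1, 0, 0)],
    [(0, 1, 0), (5, 4, 5), (12, 3, 8), (140, 13, 80), (40, -1, 20), (10, 1, 0)],
    [(10, 1, 0), (40, -1, 20), (35, -4, 20), (30, -7, 20), (20, -13, 20), (0, -1, 0)]]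

/-- Linear forms which are positive on exactly one of the six components. -/
def wall : Fin 6 → Fin 3 → ℝ × ℝ × ℝ :=
  ![![(-1, 0, 1), (110, -100, 81), (40, 100, 9)],
    ![(1, 0, -1), (-17, -20, 33), (-12, 20, 25)],
    ![(-1, 0, 1), (-110, 100, -81), (0, 20, -3)],
    ![(-1, 0, 1), (-40, -100, -9), (0, -20, 3)],
    ![(1, 0, -1), (17, 20, -33), (-2, 20, 5)],
    ![(1, 0, -1), (12, -20, -25), (2, -20, -5)]]

lemma isCrossedFan_leftOval : IsCrossedFan (apex 0) (chain 0) := by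
  simp only [apex, chain, Matrix.cons_val, IsCrossedFan]
  exact ⟨isCrossed_of_coeffs (by norm_num)
      (-6843146993) (-65766056468) (-171739503222) (-83455073140) (-63915497761) (-3044104256)
      (-11013623904) 22109298432 30051317024 1039733814 12718761180 26910614406 617006192
      2743191056 60647447
      (fun β γ t => by simp [homHess]; ring) (by norm_num) (by norm_num) (by norm_num), by norm_num,
    isCrossed_of_coeffs (by norm_num)
      (-63915497761) (-94048616388) (-3323807332614) (-5991184803652) (-2693848114401)
      30051317024 69761409984 (-356910761952) (-371943595648) 26910614406 44048651724 6448191174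
      2743191056 2401351152 60647447
      (fun β γ t => by simp [homHess]; ring) (by norm_num) (by norm_num) (by norm_num), by norm_num,
    isCrossed_of_coeffs (by norm_num)
      (-2693848114401) (-20343807765508) (-50921701042374) (-46430604009732) (-13100263014241)
      (-371943595648) (-2633670836928) (-5480502299136) (-3021356983744) 6448191174
      (-49408156404) (-98615732154) 2401351152 1717671344 60647447
      (fun β γ t => by simp [homHess]; ring) (by norm_num) (by norm_num) (by norm_num), by norm_num,
    isCrossed_of_coeffs (by norm_num)
      (-13100263014241) (-24272455390804) (-12807614572566) (-1134392053684) (-507789217681)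
      (-3021356983744) (-3499995361152) (-579120526272) (-273140452864) (-98615732154)
      (-47303494788) (-30167837034) 1717671344 1606919984 60647447
      (fun β γ t => by simp [homHess]; ring) (by norm_num) (by norm_num) (by norm_num), by norm_num,
    isCrossed_of_coeffs (by norm_num)
      (-507789217681) (-2927921687764) (-18188203474806) (-29594553221044) (-14835301576321)
      (-273140452864) (-1059722190912) (-4461198690432) (-3847275256384) (-30167837034)
      (-73367853348) (-124680090714) 1606919984 1496168624 60647447
      (fun β γ t => by simp [homHess]; ring) (by norm_num) (by norm_num) (by norm_num), by norm_num,
    isCrossed_of_coeffs (by norm_num)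
      (-14835301576321) (-118834512473764) (-341157141041766) (-417200206199524)
      (-196183385815201) (-3847275256384) (-25703079926592) (-54580936400832) (-34106398162624)
      (-124680090714) (-601344837588) (-802585044474) 1496168624 1274665904 60647447
      (fun β γ t => by simp [homHess]; ring) (by norm_num) (by norm_num) (by norm_num), by norm_num,
    isCrossed_of_coeffs (by norm_num)
      (-196183385815201) (-586378379351652) (-546505245059814) (-204553269021988)
      (-26953469480961) (-34106398162624) (-51097382269056) (-24672117866688) (-3872577265408)
      (-802585044474) (-679734608724) (-132722706906) 1274665904 2179848432 60647447
      (fun β γ t => by simp [homHess]; ring) (by norm_num) (by norm_num) (by norm_num), by norm_num,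
    isCrossed_of_coeffs (by norm_num)
      (-26953469480961) (-59444182374772) (-40253293958454) (-10086191419668) (-993013603921)
      (-3872577265408) (-5090538760992) (-1906065308736) (-212034251296) (-132722706906)
      (-58300816356) 10528604886 2179848432 2632439696 60647447
      (fun β γ t => by simp [homHess]; ring) (by norm_num) (by norm_num) (by norm_num), by norm_num,
    isCrossed_of_coeffs (by norm_num)
      (-993013603921) (-914985913692) (-775076448294) (-2124235283548) (-1187968848081)
      (-212034251296) (-1121476464) 155232076608 3827997008 10528604886 60736222836 34234296534
      2632439696 2858735328 60647447
      (fun β γ t => by simp [homHess]; ring) (by norm_num) (by norm_num) (by norm_num), by norm_num,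
    isCrossed_of_coeffs (by norm_num)
      (-1187968848081) (-1475903100220) (-661636684038) (-117675996924) (-6843146993) 3827997008
      (-26452818912) (-23044552752) (-3044104256) 34234296534 15240192660 1039733814 2858735328
      617006192 60647447
      (fun β γ t => by simp [homHess]; ring) (by norm_num) (by norm_num) (by norm_num)⟩

lemma isCrossedFan_rightOval : IsCrossedFan (apex 1) (chain 1) := by
  simp only [apex, chain, Matrix.cons_val, IsCrossedFan]
  exact ⟨isCrossed_of_coeffs (by norm_num)
      (-2875990401) (-31406885788) (-105052942854) (-126892523292) (-81792895681) (-3845944300)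
      (-24058598700) (-38300158500) (-50912988100) (-380497168) 3769208608 (-205936912) 953213176
      2552260872 214461052
      (fun β γ t => by simp [homHess]; ring) (by norm_num) (by norm_num) (by norm_num), by norm_num,
    isCrossed_of_coeffs (by norm_num)
      (-81792895681) (-14677307228) (-5984560230) (-1239879196) (-68768609) (-50912988100)
      (-15227729460) (-3830909004) (-318236092) (-205936912) (-1590058208) (-370653712)
      2552260872 129166904 214461052
      (fun β γ t => by simp [homHess]; ring) (by norm_num) (by norm_num) (by norm_num), by norm_num,
    isCrossed_of_coeffs (by norm_num)
      (-68768609) (-360779668) (-672306540) (-500619656) (-123285616) (-318236092) (-1311214392)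
      (-1798590960) (-760928200) (-370653712) (-1191194144) (-933627328) 129166904 (-76844664)
      214461052
      (fun β γ t => by simp [homHess]; ring) (by norm_num) (by norm_num) (by norm_num), by norm_num,
    isCrossed_of_coeffs (by norm_num)
      (-123285616) (-1796989768) (-7674114124) (-4219035492) (-12745318401) (-760928200)
      (-7146003760) (-7680981240) (-19349734540) (-933627328) (-3141206592) (-5243097072)
      (-76844664) 1807370712 214461052
      (fun β γ t => by simp [homHess]; ring) (by norm_num) (by norm_num) (by norm_num), by norm_num,
    isCrossed_of_coeffs (by norm_num)
      (-12745318401) (-34105131636) (-148629310486) (-130917154516) (-35208774961) (-19349734540)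
      (-27325278660) (-110937413860) (-54262464940) (-5243097072) 2078632224 (-7616307952)
      1807370712 2114749368 214461052
      (fun β γ t => by simp [homHess]; ring) (by norm_num) (by norm_num) (by norm_num), by norm_num,
    isCrossed_of_coeffs (by norm_num)
      (-35208774961) (-97103630316) (-87495811486) (-31188874236) (-3837639001) (-54262464940)
      (-78437175140) (-34030001700) (-4669258220) (-7616307952) (-3166645296) 225630048
      2114749368 1533981272 214461052
      (fun β γ t => by simp [homHess]; ring) (by norm_num) (by norm_num) (by norm_num), by norm_num,
    isCrossed_of_coeffs (by norm_num)
      (-3837639001) (-7431396888) (-3507112354) (-29580792) (-6833881) (-4669258220)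
      (-3996661140) (-81784220) (-106127140) 225630048 2260212792 978574592 1533981272 1243597224
      214461052
      (fun β γ t => by simp [homHess]; ring) (by norm_num) (by norm_num) (by norm_num), by norm_num,
    isCrossed_of_coeffs (by norm_num)
      (-6833881) (-25090256) (-3493640746) (-6460767216) (-2875990401) (-106127140) (-554978620)
      (-4943049940) (-3845944300) 978574592 1654085576 (-380497168) 1243597224 953213176
      214461052
      (fun β γ t => by simp [homHess]; ring) (by norm_num) (by norm_num) (by norm_num)⟩

lemma isCrossedFan_leftUpper : IsCrossedFan (apex 2) (chain 2) := by
  simp only [apex, chain, Matrix.cons_val, IsCrossedFan]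
  exact ⟨isCrossed_of_coeffs (by norm_num)
      (-22761) (-2651040) (-104543722) (-1559268768) (-6843146993) (-965844) (-77963688)
      (-1783213252) (-11068643592) 3329586 186485328 (-1486719442) 81569916 2093104440 117223119
      (fun β γ t => by simp [homHess]; ring) (by norm_num) (by norm_num) (by norm_num), by norm_num,
    isCrossed_of_coeffs (by norm_num)
      (-6843146993) (-117675996924) (-661636684038) (-1475903100220) (-1187968848081)
      (-11068643592) (-108575755128) (-338173808760) (-372772993032) (-1486719442) 1008350180
      22163062286 2093104440 9057947832 117223119
      (fun β γ t => by simp [homHess]; ring) (by norm_num) (by norm_num) (by norm_num), by norm_num,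
    isCrossed_of_coeffs (by norm_num)
      (-1187968848081) (-2124235283548) (-775076448294) (-914985913692) (-993013603921)
      (-372772993032) (-545768914392) (-424193619384) (-263915076456) 22163062286 83610498244
      41400761294 9057947832 7650373464 117223119
      (fun β γ t => by simp [homHess]; ring) (by norm_num) (by norm_num) (by norm_num), by norm_num,
    isCrossed_of_coeffs (by norm_num)
      (-993013603921) (-10086191419668) (-40253293958454) (-59444182374772) (-26953469480961)
      (-263915076456) (-1526848449336) (-4218459289272) (-3057264943848) 41400761294 81183571276
      (-40403888674) 7650373464 4835224728 117223119
      (fun β γ t => by simp [homHess]; ring) (by norm_num) (by norm_num) (by norm_num), by norm_num,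
    isCrossed_of_coeffs (by norm_num)
      (-26953469480961) (-204553269021988) (-546505245059814) (-586378379351652)
      (-196183385815201) (-3057264943848) (-19078465916088) (-38032035809976) (-22824747057384)
      (-40403888674) (-404790474596) (-685133380546) 4835224728 (-795072744) 117223119
      (fun β γ t => by simp [homHess]; ring) (by norm_num) (by norm_num) (by norm_num), by norm_num,
    isCrossed_of_coeffs (by norm_num)
      (-196183385815201) (-3062777808844) (-18517835926) (-55910124) (-77841) (-22824747057384)
      (-284600399672) (-1269922392) (-2164104) (-685133380546) (-5454564012) (-12138066)
      (-795072744) 10173816 117223119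
      (fun β γ t => by simp [homHess]; ring) (by norm_num) (by norm_num) (by norm_num)⟩

lemma isCrossedFan_leftLower : IsCrossedFan (apex 3) (chain 3) := by
  simp only [apex, chain, Matrix.cons_val, IsCrossedFan]
  exact ⟨isCrossed_of_coeffs (by norm_num)
      (-77841) (-18817236) (-5164396246) (-468809944436) (-13100263014241) (-2506356)
      (-558543132) (-105937064668) (-4783756385844) (-19838736) (-4426367328) (-502257433936)
      35600904 (-7468265304) 596701404
      (fun β γ t => by simp [homHess]; ring) (by norm_num) (by norm_num) (by norm_num), by norm_num,
    isCrossed_of_coeffs (by norm_num)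
      (-13100263014241) (-46430604009732) (-50921701042374) (-20343807765508) (-2693848114401)
      (-4783756385844) (-11778583661916) (-7313657185308) (-1355275572468) (-502257433936)
      (-583950952736) (-80441285584) (-7468265304) 24454865448 596701404
      (fun β γ t => by simp [homHess]; ring) (by norm_num) (by norm_num) (by norm_num), by norm_num,
    isCrossed_of_coeffs (by norm_num)
      (-2693848114401) (-5991184803652) (-3323807332614) (-94048616388) (-63915497761)
      (-1355275572468) (-2441911483452) (-1122270251676) (-165190048596) (-80441285584)
      50651619616 131405963504 24454865448 40416430824 596701404
      (fun β γ t => by simp [homHess]; ring) (by norm_num) (by norm_num) (by norm_num), by norm_num,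
    isCrossed_of_coeffs (by norm_num)
      (-63915497761) (-83455073140) (-171739503222) (-65766056468) (-6843146993) (-165190048596)
      26225992020 2595557604 (-2887894212) 131405963504 94994446880 13755173168 40416430824
      11275599240 596701404
      (fun β γ t => by simp [homHess]; ring) (by norm_num) (by norm_num) (by norm_num), by norm_num,
    isCrossed_of_coeffs (by norm_num)
      (-6843146993) (-1559268768) (-104543722) (-2651040) (-22761) (-2887894212) 61226828
      17531532 310716 13755173168 2100555288 40481856 11275599240 413279496 596701404
      (fun β γ t => by simp [homHess]; ring) (by norm_num) (by norm_num) (by norm_num)⟩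

lemma isCrossedFan_rightUpper : IsCrossedFan (apex 4) (chain 4) := by
  simp only [apex, chain, Matrix.cons_val, IsCrossedFan]
  exact ⟨isCrossed_of_coeffs (by norm_num)
      (-77841) (-1067436) (-14135596) (-74074136) (-123285616) (-2506356) (-20570832)
      (-217394368) (-620971944) (-19838736) (-34601328) (-653481136) 35600904 603039096 596701404
      (fun β γ t => by simp [homHess]; ring) (by norm_num) (by norm_num) (by norm_num), by norm_num,
    isCrossed_of_coeffs (by norm_num)
      (-123285616) (-500619656) (-672306540) (-360779668) (-68768609) (-620971944) (-1721854848)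
      (-1307536080) (-311534028) (-653481136) (-277071728) 386162960 603039096 2496937464
      596701404
      (fun β γ t => by simp [homHess]; ring) (by norm_num) (by norm_num) (by norm_num), by norm_num,
    isCrossed_of_coeffs (by norm_num)
      (-68768609) (-1239879196) (-5984560230) (-14677307228) (-81792895681) (-311534028)
      (-3558742620) (-6675519972) (-32905419252) 386162960 13801462624 78312480656 2496937464
      32629749192 596701404
      (fun β γ t => by simp [homHess]; ring) (by norm_num) (by norm_num) (by norm_num), by norm_num,
    isCrossed_of_coeffs (by norm_num)
      (-81792895681) (-126892523292) (-105052942854) (-31406885788) (-2875990401) (-32905419252)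
      (-32669328948) (-30232405884) (-6194328924) 78312480656 43808824096 4739810384 32629749192
      10072530936 596701404
      (fun β γ t => by simp [homHess]; ring) (by norm_num) (by norm_num) (by norm_num), by norm_num,
    isCrossed_of_coeffs (by norm_num)
      (-2875990401) (-9127109996) (-8144078206) (-1854687996) (-101983401) (-6194328924)
      (-7348426628) 3756510828 1212008724 4739810384 19776089232 4956146784 10072530936
      4168395864 596701404
      (fun β γ t => by simp [homHess]; ring) (by norm_num) (by norm_num) (by norm_num)⟩

lemma isCrossedFan_rightLower : IsCrossedFan (apex 5) (chain 5) := by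
  simp only [apex, chain, Matrix.cons_val, IsCrossedFan]
  exact ⟨isCrossed_of_coeffs (by norm_num)
      (-101983401) (-1854687996) (-8144078206) (-9127109996) (-2875990401) (-614659860)
      (-3574381860) (-3557170700) (-1211483580) 78766938 866117484 518284178 92811852 229038228
      2495367
      (fun β γ t => by simp [homHess]; ring) (by norm_num) (by norm_num) (by norm_num), by norm_num,
    isCrossed_of_coeffs (by norm_num)
      (-2875990401) (-6460767216) (-3493640746) (-25090256) (-6833881) (-1211483580) (-490238440)
      645888820 44598200 518284178 1004987104 387010718 229038228 175928472 2495367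
      (fun β γ t => by simp [homHess]; ring) (by norm_num) (by norm_num) (by norm_num), by norm_num,
    isCrossed_of_coeffs (by norm_num)
      (-6833881) (-29580792) (-3507112354) (-7431396888) (-3837639001) 44598200 (-378299620)
      (-2538615320) (-1995762980) 387010718 543055768 56352842 175928472 122818716 2495367
      (fun β γ t => by simp [homHess]; ring) (by norm_num) (by norm_num) (by norm_num), by norm_num,
    isCrossed_of_coeffs (by norm_num)
      (-3837639001) (-31188874236) (-87495811486) (-97103630316) (-35208774961) (-1995762980)
      (-12884636180) (-24935415100) (-13086905740) 56352842 (-747994484) (-1203116158) 122818716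
      16599204 2495367
      (fun β γ t => by simp [homHess]; ring) (by norm_num) (by norm_num) (by norm_num), by norm_num,
    isCrossed_of_coeffs (by norm_num)
      (-35208774961) (-5198380868) (-247487494) (-4759812) (-77841) (-13086905740) (-1255069700)
      (-39936420) (-1052460) (-1203116158) (-67107132) (-3668382) 16599204 (-2681532) 2495367
      (fun β γ t => by simp [homHess]; ring) (by norm_num) (by norm_num) (by norm_num)⟩

lemma mem_fan_leftOval {p : ℝ × ℝ} (hp : p ∈ Z)
    (h : ∀ j, 0 ≤ form (wall 0 j) (p.1, p.2, 1)) : p ∈ fan (apex 0) (chain 0) := by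
  have h0 := h 0
  have h1 := h 1
  have h2 := h 2
  simp only [wall, form, Matrix.cons_val] at h0 h1 h2
  have hl : (chain 0).IsChain
      fun B C => 0 < det₃ (apex 0) B C ∧ 0 ≤ det₃ (p.1, p.2, 1) B C := by
    simp only [apex, chain, Matrix.cons_val, List.isChain_cons_cons, List.IsChain.singleton,
      and_true, det₃]
    refine ⟨⟨?_, ?_⟩, ⟨?_, ?_⟩, ⟨?_, ?_⟩, ⟨?_, ?_⟩, ⟨?_, ?_⟩, ⟨?_, ?_⟩, ⟨?_, ?_⟩, ⟨?_, ?_⟩, ⟨?_, ?_⟩, ⟨?_, ?_⟩⟩ <;> linarith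
  by_cases e₀ : 0 ≤ det₃ (apex 0) (-12, 3, 20) (p.1, p.2, 1) ∧ det₃ (apex 0) (100, -49, 100) (p.1, p.2, 1) ≤ 0
  · exact isCrossedFan_leftOval.mem_fan_of_drop hp hl 0 rfl e₀.1 ⟨_, by simp, e₀.2⟩
  by_cases e₁ : 0 ≤ det₃ (apex 0) (100, -49, 100) (p.1, p.2, 1) ∧ det₃ (apex 0) (100, 191, 100) (p.1, p.2, 1) ≤ 0
  · exact isCrossedFan_leftOval.mem_fan_of_drop hp hl 3 rfl e₁.1 ⟨_, by simp, e₁.2⟩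
  refine isCrossedFan_leftOval.mem_fan_of_drop hp hl 6 rfl (B := (100, 191, 100)) ?_ ⟨(-12, 3, 20), by simp, ?_⟩ <;>
  · simp only [apex, Matrix.cons_val, det₃] at e₀ e₁ ⊢
    grind

lemma mem_fan_rightOval {p : ℝ × ℝ} (hp : p ∈ Z)
    (h : ∀ j, 0 ≤ form (wall 1 j) (p.1, p.2, 1)) : p ∈ fan (apex 1) (chain 1) := by
  have h0 := h 0
  have h1 := h 1
  have h2 := h 2
  simp only [wall, form, Matrix.cons_val] at h0 h1 h2
  have hl : (chain 1).IsChain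
      fun B C => 0 < det₃ (apex 1) B C ∧ 0 ≤ det₃ (p.1, p.2, 1) B C := by
    simp only [apex, chain, Matrix.cons_val, List.isChain_cons_cons, List.IsChain.singleton,
      and_true, det₃]
    refine ⟨⟨?_, ?_⟩, ⟨?_, ?_⟩, ⟨?_, ?_⟩, ⟨?_, ?_⟩, ⟨?_, ?_⟩, ⟨?_, ?_⟩, ⟨?_, ?_⟩, ⟨?_, ?_⟩⟩ <;> linarith
  by_cases e₀ : 0 ≤ det₃ (apex 1) (40, -1, 20) (p.1, p.2, 1) ∧ det₃ (apex 1) (5, 4, 5) (p.1, p.2, 1) ≤ 0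
  · exact isCrossedFan_rightOval.mem_fan_of_drop hp hl 0 rfl e₀.1 ⟨_, by simp, e₀.2⟩
  by_cases e₁ : 0 ≤ det₃ (apex 1) (5, 4, 5) (p.1, p.2, 1) ∧ det₃ (apex 1) (20, -13, 20) (p.1, p.2, 1) ≤ 0
  · exact isCrossedFan_rightOval.mem_fan_of_drop hp hl 3 rfl e₁.1 ⟨_, by simp, e₁.2⟩
  refine isCrossedFan_rightOval.mem_fan_of_drop hp hl 5 rfl (B := (20, -13, 20)) ?_ ⟨(40, -1, 20), by simp, ?_⟩ <;>
  · simp only [apex, Matrix.cons_val, det₃] at e₀ e₁ ⊢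
    grind

lemma mem_fan_leftUpper {p : ℝ × ℝ} (hp : p ∈ Z)
    (h : ∀ j, 0 ≤ form (wall 2 j) (p.1, p.2, 1)) : p ∈ fan (apex 2) (chain 2) := by
  have h0 := h 0
  have h1 := h 1
  have h2 := h 2
  simp only [wall, form, Matrix.cons_val] at h0 h1 h2
  have hl : (chain 2).IsChain
      fun B C => 0 < det₃ (apex 2) B C ∧ 0 ≤ det₃ (p.1, p.2, 1) B C := by
    simp only [apex, chain, Matrix.cons_val, List.isChain_cons_cons, List.IsChain.singleton,
      and_true, det₃]
    refine ⟨⟨?_, ?_⟩, ⟨?_, ?_⟩, ⟨?_, ?_⟩, ⟨?_, ?_⟩, ⟨?_, ?_⟩, ⟨?_, ?_⟩⟩ <;> linarith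
  refine isCrossedFan_leftUpper.mem_fan_of_drop hp hl 0 rfl ?_ ⟨(0, 1, 0), by simp, ?_⟩ <;>
  · simp only [apex, Matrix.cons_val, det₃]
    norm_num

lemma mem_fan_leftLower {p : ℝ × ℝ} (hp : p ∈ Z)
    (h : ∀ j, 0 ≤ form (wall 3 j) (p.1, p.2, 1)) : p ∈ fan (apex 3) (chain 3) := by
  have h0 := h 0
  have h1 := h 1
  have h2 := h 2
  simp only [wall, form, Matrix.cons_val] at h0 h1 h2
  have hl : (chain 3).IsChain
      fun B C => 0 < det₃ (apex 3) B C ∧ 0 ≤ det₃ (p.1, p.2, 1) B C := by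
    simp only [apex, chain, Matrix.cons_val, List.isChain_cons_cons, List.IsChain.singleton,
      and_true, det₃]
    refine ⟨⟨?_, ?_⟩, ⟨?_, ?_⟩, ⟨?_, ?_⟩, ⟨?_, ?_⟩, ⟨?_, ?_⟩⟩ <;> linarith
  refine isCrossedFan_leftLower.mem_fan_of_drop hp hl 0 rfl ?_ ⟨(-1, 0, 0), by simp, ?_⟩ <;>
  · simp only [apex, Matrix.cons_val, det₃]
    norm_num

lemma mem_fan_rightUpper {p : ℝ × ℝ} (hp : p ∈ Z)
    (h : ∀ j, 0 ≤ form (wall 4 j) (p.1, p.2, 1)) : p ∈ fan (apex 4) (chain 4) := by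
  have h0 := h 0
  have h1 := h 1
  have h2 := h 2
  simp only [wall, form, Matrix.cons_val] at h0 h1 h2
  have hl : (chain 4).IsChain
      fun B C => 0 < det₃ (apex 4) B C ∧ 0 ≤ det₃ (p.1, p.2, 1) B C := by
    simp only [apex, chain, Matrix.cons_val, List.isChain_cons_cons, List.IsChain.singleton,
      and_true, det₃]
    refine ⟨⟨?_, ?_⟩, ⟨?_, ?_⟩, ⟨?_, ?_⟩, ⟨?_, ?_⟩, ⟨?_, ?_⟩⟩ <;> linarith
  refine isCrossedFan_rightUpper.mem_fan_of_drop hp hl 0 rfl ?_ ⟨(10, 1, 0), by simp, ?_⟩ <;>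
  · simp only [apex, Matrix.cons_val, det₃]
    norm_num

lemma mem_fan_rightLower {p : ℝ × ℝ} (hp : p ∈ Z)
    (h : ∀ j, 0 ≤ form (wall 5 j) (p.1, p.2, 1)) : p ∈ fan (apex 5) (chain 5) := by
  have h0 := h 0
  have h1 := h 1
  have h2 := h 2
  simp only [wall, form, Matrix.cons_val] at h0 h1 h2
  have hl : (chain 5).IsChain
      fun B C => 0 < det₃ (apex 5) B C ∧ 0 ≤ det₃ (p.1, p.2, 1) B C := by
    simp only [apex, chain, Matrix.cons_val, List.isChain_cons_cons, List.IsChain.singleton,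
      and_true, det₃]
    refine ⟨⟨?_, ?_⟩, ⟨?_, ?_⟩, ⟨?_, ?_⟩, ⟨?_, ?_⟩, ⟨?_, ?_⟩⟩ <;> linarith
  refine isCrossedFan_rightLower.mem_fan_of_drop hp hl 0 rfl ?_ ⟨(0, -1, 0), by simp, ?_⟩ <;>
  · simp only [apex, Matrix.cons_val, det₃]
    norm_num

lemma isCrossedFan_chain (i : Fin 6) : IsCrossedFan (apex i) (chain i) := by
  fin_cases i
  exacts [isCrossedFan_leftOval, isCrossedFan_rightOval,
    isCrossedFan_leftUpper, isCrossedFan_leftLower,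
    isCrossedFan_rightUpper, isCrossedFan_rightLower]

lemma mem_fan_of_wall_nonneg {p : ℝ × ℝ} (hp : p ∈ Z) {i : Fin 6}
    (h : ∀ j, 0 ≤ form (wall i j) (p.1, p.2, 1)) : p ∈ fan (apex i) (chain i) := by
  fin_cases i
  exacts [mem_fan_leftOval hp h, mem_fan_rightOval hp h, mem_fan_leftUpper hp h, mem_fan_leftLower hp h, mem_fan_rightUpper hp h, mem_fan_rightLower hp h]

lemma exists_wall_nonneg (p : ℝ × ℝ) :
    ∃ i : Fin 6, ∀ j, 0 ≤ form (wall i j) (p.1, p.2, 1) := by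
  by_contra! hne
  have h := fun i => hne i
  simp only [Fin.forall_fin_succ, Fin.exists_fin_succ, wall, form] at h
  simp at h
  grind

/-- The open region cut out by the walls of a component. -/
def openRegion (i : Fin 6) : Set (ℝ × ℝ) := {p | ∀ j, 0 < form (wall i j) (p.1, p.2, 1)}

lemma isOpen_openRegion (i : Fin 6) : IsOpen (openRegion i) := by
  have : openRegion i = ⋂ j, {p : ℝ × ℝ | 0 < form (wall i j) (p.1, p.2, 1)} := by
    ext; simp [openRegion]
  rw [this]
  refine isOpen_iInter_of_finite fun j => isOpen_lt continuous_const ?_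
  unfold form
  fun_prop

lemma disjoint_openRegion : Pairwise fun i j => Disjoint (openRegion i) (openRegion j) := by
  intro i j hij
  refine Set.disjoint_left.2 fun p hi hj => ?_
  have a0 := hi 0
  have a1 := hi 1
  have a2 := hi 2
  have b0 := hj 0
  have b1 := hj 1
  have b2 := hj 2
  fin_cases i <;> fin_cases j <;> first
    | exact hij rfl
    | simp [wall, form] at a0 a1 a2 b0 b1 b2; linarith

lemma inter_fan_subset_openRegion (i : Fin 6) :
    Z ∩ fan (apex i) (chain i) ⊆ openRegion i := by
  intro p hp j
  refine (isCrossedFan_chain i).form_pos ?_ ?_ hp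
  · fin_cases i <;> fin_cases j <;> norm_num [form, wall, apex]
  · fin_cases i <;> fin_cases j <;> norm_num [form, wall, chain]

lemma nonempty_inter_fan (i : Fin 6) : (Z ∩ fan (apex i) (chain i)).Nonempty := by
  have h := isCrossedFan_chain i
  fin_cases i <;> exact h.nonempty

lemma isBounded_inter_fan_iff (i : Fin 6) :
    Bornology.IsBounded (Z ∩ fan (apex i) (chain i)) ↔ i ∈ ({0, 1} : Set (Fin 6)) := by
  have hb : ∀ i ∈ ({0, 1} : Set (Fin 6)), Bornology.IsBounded (openRegion i) := by
    intro i hi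
    refine (Metric.isBounded_Icc ((-10, -10) : ℝ × ℝ) (10, 10)).subset fun p hp => ?_
    have h0 := hp 0
    have h1 := hp 1
    have h2 := hp 2
    rcases hi with rfl | rfl <;> simp [wall, form] at h0 h1 h2 <;>
      refine ⟨⟨?_, ?_⟩, ?_, ?_⟩ <;> simp only <;> linarith
  have hu : ∀ i ∉ ({0, 1} : Set (Fin 6)),
      ¬ Bornology.IsBounded (Z ∩ fan (apex i) (chain i)) := by
    intro i hi
    have h := isCrossedFan_chain i
    fin_cases i
    · simp at hi
    · simp at hi
    · exact h.not_isBounded rfl rfl (by norm_num) (a := -1) (b := 0) (by norm_num [apex])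
        (by norm_num)
    · exact h.not_isBounded rfl rfl (by norm_num) (a := 0) (b := -1) (by norm_num [apex])
        (by norm_num)
    · exact h.not_isBounded rfl rfl (by norm_num) (a := 0) (b := 1) (by norm_num [apex])
        (by norm_num)
    · exact h.not_isBounded rfl rfl (by norm_num) (a := 1) (b := 0) (by norm_num [apex])
        (by norm_num)
  exact ⟨fun h => by_contra fun hi => hu i hi h,
    fun hi => (hb i hi).subset (inter_fan_subset_openRegion i)⟩

lemma Z_eq_iUnion : Z = ⋃ i, Z ∩ fan (apex i) (chain i) := by
  refine Set.Subset.antisymm (fun p hp => ?_) (Set.iUnion_subset fun i => Set.inter_subset_left)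
  obtain ⟨i, hi⟩ := exists_wall_nonneg p
  exact Set.mem_iUnion.2 ⟨i, hp, mem_fan_of_wall_nonneg hp hi⟩

/-- The hessian curve of `f` has exactly 6 connected components: 2 bounded (ovals)
and 4 unbounded. -/
theorem hessian_curve_components :
    (components Z).ncard = 6 ∧
    {C ∈ components Z | Bornology.IsBounded C}.ncard = 2 ∧
    {C ∈ components Z | ¬ Bornology.IsBounded C}.ncard = 4 := by
  obtain ⟨hrange, hinj⟩ := components_eq_range isOpen_openRegion disjoint_openRegion
    (fun i => (isCrossedFan_chain i).isPreconnected) nonempty_inter_fan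
    inter_fan_subset_openRegion Z_eq_iUnion
  have hsep : ∀ P : Set (ℝ × ℝ) → Prop, {C ∈ components Z | P C} =
      (fun i => Z ∩ fan (apex i) (chain i)) '' {i | P (Z ∩ fan (apex i) (chain i))} := by
    intro P
    rw [hrange]
    ext C
    constructor
    · rintro ⟨⟨i, rfl⟩, hC⟩
      exact ⟨i, hC, rfl⟩
    · rintro ⟨i, hi, rfl⟩
      exact ⟨⟨i, rfl⟩, hi⟩
  refine ⟨?_, ?_, ?_⟩
  · rw [hrange, ← Set.image_univ, Set.ncard_image_of_injective _ hinj, Set.ncard_univ,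
      Nat.card_eq_fintype_card, Fintype.card_fin]
  · rw [hsep, Set.ncard_image_of_injective _ hinj]
    simp_rw [isBounded_inter_fan_iff]
    exact Set.ncard_pair (by decide)
  · rw [hsep, Set.ncard_image_of_injective _ hinj]
    simp_rw [isBounded_inter_fan_iff]
    change ({0, 1} : Set (Fin 6))ᶜ.ncard = 4
    rw [Set.ncard_compl, Set.ncard_pair (by decide), Nat.card_eq_fintype_card, Fintype.card_fin]
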